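/- arXiv:1703.02307 — 2 statements merged into one kernel-verified Lean document; each statement's English description precedes it below -/
import Mathlib

section
/- Let m, K ≥ 1 and let 𝔯 = ((R_k, ζ_k))_{k=1,…,K} be a reference family. For each k define ζ̃_k := V̄_𝔯(R_k) = min( min_{1≤j≤K} (|R_k \ R_j| + ζ_j), |R_k| ), and let 𝔯̃ = ((R_k, ζ̃_k))_{k=1,…,K}. Then for every R ⊆ {1,…,m}, V̄_𝔯(R) = min_{1≤k≤K} ( (|R \ R_k| + ζ̃_k) ) ∧ |R| = V̄_𝔯̃(R). -/
/-- The interpolation bound `V̄_𝔯(R) = min( min_{1≤k≤K} (|R \ R_k| + ζ_k), |R| )`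
for a reference family `𝔯 = ((R_k, ζ_k))_{k=1,…,K}`. -/
noncomputable def Vbar {m K : ℕ} (Rk : Fin K → Finset (Fin m)) (ζ : Fin K → ℕ)
    (R : Finset (Fin m)) : ℕ :=
  sInf (insert R.card (Set.range fun k : Fin K => (R \ Rk k).card + ζ k))

theorem le_Vbar_iff {m K : ℕ} (Rk : Fin K → Finset (Fin m)) (ζ : Fin K → ℕ)
    (R : Finset (Fin m)) (n : ℕ) :
    n ≤ Vbar Rk ζ R ↔ n ≤ R.card ∧ ∀ k, n ≤ (R \ Rk k).card + ζ k := by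
  rw [Vbar, le_csInf_iff (OrderBot.bddBelow _) (Set.insert_nonempty _ _)]
  simp

theorem Vbar_le_card {m K : ℕ} (Rk : Fin K → Finset (Fin m)) (ζ : Fin K → ℕ)
    (R : Finset (Fin m)) : Vbar Rk ζ R ≤ R.card :=
  ((le_Vbar_iff Rk ζ R _).1 le_rfl).1

theorem Vbar_le_card_sdiff_add {m K : ℕ} (Rk : Fin K → Finset (Fin m)) (ζ : Fin K → ℕ)
    (R : Finset (Fin m)) (k : Fin K) : Vbar Rk ζ R ≤ (R \ Rk k).card + ζ k :=
  ((le_Vbar_iff Rk ζ R _).1 le_rfl).2 k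

theorem card_sdiff_le_add {α : Type*} [DecidableEq α] (R S T : Finset α) :
    (R \ T).card ≤ (R \ S).card + (S \ T).card :=
  (Finset.card_le_card (sdiff_triangle R S T)).trans (Finset.card_union_le _ _)

theorem Vbar_le_card_sdiff_add_Vbar {m K : ℕ} (Rk : Fin K → Finset (Fin m)) (ζ : Fin K → ℕ)
    (R S : Finset (Fin m)) : Vbar Rk ζ R ≤ (R \ S).card + Vbar Rk ζ S := by
  rw [← tsub_le_iff_left, le_Vbar_iff]
  refine ⟨?_, fun k => ?_⟩
  · have h := Vbar_le_card Rk ζ R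
    have h' := card_sdiff_le_add R S ∅
    simp only [Finset.sdiff_empty] at h'
    omega
  · have h := Vbar_le_card_sdiff_add Rk ζ R k
    have h' := card_sdiff_le_add R S (Rk k)
    omega

theorem stmt4 (m K : ℕ) (hm : 1 ≤ m) (hK : 1 ≤ K)
    (Rk : Fin K → Finset (Fin m)) (ζ : Fin K → ℕ) (R : Finset (Fin m)) :
    Vbar Rk ζ R = Vbar Rk (fun k => Vbar Rk ζ (Rk k)) R := by
  apply le_antisymm
  · rw [le_Vbar_iff]
    exact ⟨Vbar_le_card Rk ζ R, fun k => Vbar_le_card_sdiff_add_Vbar Rk ζ R (Rk k)⟩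
  · rw [le_Vbar_iff]
    refine ⟨Vbar_le_card _ _ R, fun k => (Vbar_le_card_sdiff_add _ _ R k).trans ?_⟩
    simpa using Vbar_le_card_sdiff_add Rk ζ (Rk k) k
end

section
/- (λ-calibration for known dependence.) Let (Ω, ℱ, P) be a probability space, m, K ≥ 1, and let p = (p_1,…,p_m) and q = (q_1,…,q_m) be measurable maps Ω → [0,1]^m. Let H0 ⊆ {1,…,m} be nonempty with m0 = |H0|, and assume that for every i ∈ H0, p_i ≥ q_i almost surely. Let (t_k)_{1≤k≤K} be a (deterministic) template of size K. For α ∈ (0,1) and nonempty A ⊆ {1,…,m}, define Λ(α, A) = sup{ λ ∈ [0,1] : P( min_{1≤k≤min(K,|A|)} t_k^{-1}( q_{(k:A)} ) < λ ) ≤ α }. Then: (i) A ⊆ A' implies Λ(α, A') ≤ Λ(α, A); and (ii) P( min_{1≤k≤min(K,m0)} t_k^{-1}( p_{(k:H0)} ) < Λ(α, H0) ) ≤ α; in particular P( ∃ k ∈ {1,…, min(K,m0)} : p_{(k:H0)} < t_k( Λ(α, {1,…,m}) ) ) ≤ α. -/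
open MeasureTheory Filter

/-- `orderStat A f k` is the `k`-th smallest element (1-based) of the multiset
`{f(i) : i ∈ A}`. -/
noncomputable def orderStat {m : ℕ} (A : Finset (Fin m)) (f : Fin m → ℝ) (k : ℕ) : ℝ :=
  ((A.val.map f).sort (· ≤ ·)).getD (k - 1) 0

/-- Generalized inverse `t⁻¹(y) = max{x ∈ [0,1] : t(x) ≤ y}` of a template function,
expressed as a supremum. -/
noncomputable def tinv (t : ℝ → ℝ) (y : ℝ) : ℝ :=
  sSup {x | x ∈ Set.Icc (0 : ℝ) 1 ∧ t x ≤ y}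

/-- `Psi t K A f = min_{1 ≤ k ≤ min(K,|A|)} t_k⁻¹( f_{(k:A)} )`. -/
noncomputable def Psi {m : ℕ} (t : ℕ → ℝ → ℝ) (K : ℕ) (A : Finset (Fin m))
    (f : Fin m → ℝ) : ℝ :=
  sInf ((fun k => tinv (t k) (orderStat A f k)) '' Set.Icc 1 (min K A.card))

/-- The λ-calibration for known dependence:
`Λ(α, A) = sup{ λ ∈ [0,1] : P( min_{1≤k≤min(K,|A|)} t_k⁻¹(q_{(k:A)}) < λ ) ≤ α }`. -/
noncomputable def LamKnown {Ω : Type*} [MeasurableSpace Ω] {m : ℕ} (P : Measure Ω)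
    (q : Fin m → Ω → ℝ) (t : ℕ → ℝ → ℝ) (K : ℕ) (α : ℝ) (A : Finset (Fin m)) : ℝ :=
  sSup {lam | lam ∈ Set.Icc (0 : ℝ) 1 ∧
    P {ω | Psi t K A (fun i => q i ω) < lam} ≤ ENNReal.ofReal α}

theorem getD_lt_iff_lt_countP {l : List ℝ} (hl : l.Pairwise (· ≤ ·)) (s d : ℝ) {i : ℕ}
    (hi : i < l.length) : l.getD i d < s ↔ i < l.countP (fun x => decide (x < s)) := by
  induction l generalizing i with
  | nil => simp at hi
  | cons a l ih =>
    obtain ⟨ha, hl⟩ := List.pairwise_cons.1 hl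
    by_cases has : a < s
    · cases i with
      | zero => simp [has]
      | succ i =>
        have hi' : i < l.length := by simpa using hi
        simpa [has] using ih hl hi'
    · have hzero : l.countP (fun x => decide (x < s)) = 0 := by
        rw [List.countP_eq_zero]
        intro x hx
        simpa using (not_lt.1 has).trans (ha x hx)
      cases i with
      | zero => simp [has, hzero]
      | succ i =>
        have hi' : i < l.length := by simpa using hi
        simpa [has, hzero] using ih hl hi'

section OrderStat

variable {m : ℕ}

theorem orderStat_lt_iff (A : Finset (Fin m)) (f : Fin m → ℝ) (s : ℝ) {k : ℕ}
    (hk : k ∈ Set.Icc 1 A.card) :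
    orderStat A f k < s ↔ k ≤ (A.filter fun i => f i < s).card := by
  obtain ⟨hk1, hkA⟩ := hk
  have hcount : ((A.val.map f).sort (· ≤ ·)).countP (fun x => decide (x < s)) =
      (A.filter fun i => f i < s).card := by
    rw [← Multiset.coe_countP, Multiset.sort_eq, Multiset.countP_map]
    rfl
  have hlen : k - 1 < ((A.val.map f).sort (· ≤ ·)).length := by
    rw [Multiset.length_sort, Multiset.card_map]
    change k - 1 < A.card
    omega
  rw [orderStat, getD_lt_iff_lt_countP (Multiset.pairwise_sort (A.val.map f) (· ≤ ·)) s 0 hlen, hcount]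
  omega

theorem orderStat_le_of_subset {A A' : Finset (Fin m)} (h : A ⊆ A') {f g : Fin m → ℝ}
    (hfg : ∀ i ∈ A, f i ≤ g i) {k : ℕ} (hk : k ∈ Set.Icc 1 A.card) :
    orderStat A' f k ≤ orderStat A g k := by
  refine le_of_forall_gt fun s hs => ?_
  rw [orderStat_lt_iff A g s hk] at hs
  rw [orderStat_lt_iff A' f s ⟨hk.1, hk.2.trans (Finset.card_le_card h)⟩]
  refine hs.trans (Finset.card_le_card fun i hi => ?_)
  rw [Finset.mem_filter] at hi ⊢
  exact ⟨h hi.1, (hfg i hi.1).trans_lt hi.2⟩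

theorem orderStat_nonneg {A : Finset (Fin m)} {f : Fin m → ℝ} (hf : ∀ i, 0 ≤ f i) {k : ℕ}
    (hk : k ∈ Set.Icc 1 A.card) : 0 ≤ orderStat A f k := by
  rw [← not_lt, orderStat_lt_iff A f 0 hk]
  rw [Finset.filter_eq_empty_iff.2 fun i _ => (hf i).not_gt, Finset.card_empty]
  exact not_le.2 hk.1

end OrderStat

section GeneralizedInverse

theorem tinv_nonneg (t : ℝ → ℝ) (y : ℝ) : 0 ≤ tinv t y :=
  Real.sSup_nonneg fun _ hx => hx.1.1

theorem tinv_mono {t : ℝ → ℝ} (ht0 : t 0 = 0) {y z : ℝ} (hy : 0 ≤ y) (hyz : y ≤ z) :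
    tinv t y ≤ tinv t z :=
  csSup_le_csSup ⟨1, fun _ hx => hx.1.2⟩ ⟨0, ⟨le_rfl, zero_le_one⟩, ht0.trans_le hy⟩
    fun _ hx => ⟨hx.1, hx.2.trans hyz⟩

theorem tinv_lt_of_lt {t : ℝ → ℝ} (ht0 : t 0 = 0) (hmono : MonotoneOn t (Set.Icc 0 1))
    (hlc : ∀ x ∈ Set.Ioc (0 : ℝ) 1, Tendsto t (nhdsWithin x (Set.Ico (0 : ℝ) x)) (nhds (t x)))
    {x y : ℝ} (hx : x ∈ Set.Icc (0 : ℝ) 1) (hy : 0 ≤ y) (h : y < t x) : tinv t y < x := by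
  have hx0 : 0 < x := hx.1.lt_of_ne fun h0 => by
    subst h0
    linarith
  have : (nhdsWithin x (Set.Ico (0 : ℝ) x)).NeBot := by
    rw [nhdsWithin_Ico_eq_nhdsLT hx0]
    infer_instance
  obtain ⟨z, hyz, hz⟩ := (((hlc x ⟨hx0, hx.2⟩).eventually_const_lt h).and
    self_mem_nhdsWithin).exists
  refine lt_of_le_of_lt (csSup_le ⟨0, ⟨le_rfl, zero_le_one⟩, ht0.trans_le hy⟩ ?_) hz.2
  intro w hw
  by_contra! hzw
  exact absurd (hmono ⟨hz.1, hz.2.le.trans hx.2⟩ hw.1 hzw.le) (not_le.2 (hw.2.trans_lt hyz))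

end GeneralizedInverse

section Psi

variable {m : ℕ} {t : ℕ → ℝ → ℝ} {K : ℕ}

theorem Psi_nonneg (t : ℕ → ℝ → ℝ) (K : ℕ) (A : Finset (Fin m)) (f : Fin m → ℝ) :
    0 ≤ Psi t K A f := by
  refine Real.sInf_nonneg ?_
  rintro _ ⟨k, -, rfl⟩
  exact tinv_nonneg _ _

theorem Psi_le (A : Finset (Fin m)) (f : Fin m → ℝ) {k : ℕ}
    (hk : k ∈ Set.Icc 1 (min K A.card)) : Psi t K A f ≤ tinv (t k) (orderStat A f k) := by
  refine csInf_le ⟨0, ?_⟩ ⟨k, hk, rfl⟩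
  rintro _ ⟨k, -, rfl⟩
  exact tinv_nonneg _ _

theorem Psi_le_of_subset (hK : 1 ≤ K) (ht0 : ∀ k ∈ Finset.Icc 1 K, t k 0 = 0)
    {A A' : Finset (Fin m)} (hA : A.Nonempty) (h : A ⊆ A') {f g : Fin m → ℝ}
    (hf : ∀ i, 0 ≤ f i) (hfg : ∀ i ∈ A, f i ≤ g i) : Psi t K A' f ≤ Psi t K A g := by
  refine le_csInf (Set.Nonempty.image _ ⟨1, le_rfl, le_min hK hA.card_pos⟩) ?_
  rintro _ ⟨k, ⟨hk1, hk⟩, rfl⟩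
  obtain ⟨hkK, hkA⟩ := le_min_iff.1 hk
  have hkA' := hkA.trans (Finset.card_le_card h)
  exact (Psi_le A' f ⟨hk1, le_min hkK hkA'⟩).trans
    (tinv_mono (ht0 k (Finset.mem_Icc.2 ⟨hk1, hkK⟩)) (orderStat_nonneg hf ⟨hk1, hkA'⟩)
      (orderStat_le_of_subset h hfg ⟨hk1, hkA⟩))

end Psi

theorem MeasureTheory.Measure.measure_lt_le_of_forall_lt {Ω : Type*} [MeasurableSpace Ω]
    (P : Measure Ω) (X : Ω → ℝ) {L : ℝ} {c : ENNReal}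
    (h : ∀ l < L, P {ω | X ω < l} ≤ c) : P {ω | X ω < L} ≤ c := by
  obtain ⟨u, hu, huL, hlim⟩ := exists_seq_strictMono_tendsto L
  have hunion : {ω | X ω < L} = ⋃ n, {ω | X ω < u n} := by
    ext ω
    simp only [Set.mem_ofPred_eq, Set.mem_iUnion]
    exact ⟨fun hω => (hlim.eventually_const_lt hω).exists,
      fun ⟨n, hn⟩ => hn.trans (huL n)⟩
  have hmono : Monotone fun n => {ω | X ω < u n} := fun a b hab ω hω =>
    lt_of_lt_of_le hω (hu.monotone hab)
  rw [hunion, hmono.measure_iUnion]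
  exact iSup_le fun n => h _ (huL n)

section LamKnown

variable {Ω : Type*} [MeasurableSpace Ω] {m : ℕ} (P : Measure Ω)
  (q : Fin m → Ω → ℝ) (t : ℕ → ℝ → ℝ) (K : ℕ) (α : ℝ)

theorem zero_mem_LamKnown_set (A : Finset (Fin m)) :
    (0 : ℝ) ∈ {lam | lam ∈ Set.Icc (0 : ℝ) 1 ∧
      P {ω | Psi t K A (fun i => q i ω) < lam} ≤ ENNReal.ofReal α} := by
  refine ⟨⟨le_rfl, zero_le_one⟩, ?_⟩
  simp [(Psi_nonneg t K A _).not_gt]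

theorem LamKnown_mem_Icc (A : Finset (Fin m)) :
    LamKnown P q t K α A ∈ Set.Icc (0 : ℝ) 1 :=
  ⟨Real.sSup_nonneg fun _ hx => hx.1.1,
    csSup_le ⟨0, zero_mem_LamKnown_set P q t K α A⟩ fun _ hx => hx.1.2⟩

theorem measure_Psi_lt_LamKnown_le (A : Finset (Fin m)) :
    P {ω | Psi t K A (fun i => q i ω) < LamKnown P q t K α A} ≤ ENNReal.ofReal α := by
  refine P.measure_lt_le_of_forall_lt _ fun l hl => ?_
  obtain ⟨l', hl', hll'⟩ := exists_lt_of_lt_csSup ⟨0, zero_mem_LamKnown_set P q t K α A⟩ hl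
  exact (measure_mono fun ω hω => lt_trans hω hll').trans hl'.2

variable {q t K}

theorem LamKnown_anti (hK : 1 ≤ K) (ht0 : ∀ k ∈ Finset.Icc 1 K, t k 0 = 0)
    (hq : ∀ i ω, 0 ≤ q i ω) {A A' : Finset (Fin m)} (hA : A.Nonempty) (h : A ⊆ A') :
    LamKnown P q t K α A' ≤ LamKnown P q t K α A :=
  csSup_le_csSup ⟨1, fun _ hx => hx.1.2⟩ ⟨0, zero_mem_LamKnown_set P q t K α A'⟩
    fun _ hx => ⟨hx.1, (measure_mono fun ω hω =>
      (Psi_le_of_subset hK ht0 hA h (fun i => hq i ω) fun _ _ => le_rfl).trans_lt hω).trans hx.2⟩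

end LamKnown

/-- **λ-calibration for known dependence.**  If `p_i ≥ q_i` a.s. for all `i ∈ H0`, then:
(i) `Λ(α, ·)` is nonincreasing; (ii) `P( min_k t_k⁻¹(p_{(k:H0)}) < Λ(α, H0) ) ≤ α`;
in particular `P( ∃ k ≤ min(K,m₀) : p_{(k:H0)} < t_k(Λ(α, {1,…,m})) ) ≤ α`. -/
theorem stmt15 {Ω : Type*} [MeasurableSpace Ω] (P : Measure Ω) [IsProbabilityMeasure P]
    (m K : ℕ) (hm : 1 ≤ m) (hK : 1 ≤ K)
    (p q : Fin m → Ω → ℝ) (hpmeas : ∀ i, Measurable (p i)) (hqmeas : ∀ i, Measurable (q i))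
    (hprange : ∀ i ω, p i ω ∈ Set.Icc (0 : ℝ) 1)
    (hqrange : ∀ i ω, q i ω ∈ Set.Icc (0 : ℝ) 1)
    (H0 : Finset (Fin m)) (hH0 : H0.Nonempty)
    (hdom : ∀ i ∈ H0, ∀ᵐ ω ∂P, q i ω ≤ p i ω)
    (t : ℕ → ℝ → ℝ)
    (htmap : ∀ k ∈ Finset.Icc 1 K, ∀ x ∈ Set.Icc (0 : ℝ) 1, t k x ∈ Set.Icc (0 : ℝ) 1)
    (ht0 : ∀ k ∈ Finset.Icc 1 K, t k 0 = 0)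
    (htmono : ∀ k ∈ Finset.Icc 1 K, MonotoneOn (t k) (Set.Icc (0 : ℝ) 1))
    (htlc : ∀ k ∈ Finset.Icc 1 K, ∀ x ∈ Set.Ioc (0 : ℝ) 1,
      Tendsto (t k) (nhdsWithin x (Set.Ico (0 : ℝ) x)) (nhds (t k x)))
    (α : ℝ) (hα : α ∈ Set.Ioo (0 : ℝ) 1) :
    (∀ A A' : Finset (Fin m), A.Nonempty → A ⊆ A' →
      LamKnown P q t K α A' ≤ LamKnown P q t K α A) ∧
    P {ω | Psi t K H0 (fun i => p i ω) < LamKnown P q t K α H0} ≤ ENNReal.ofReal α ∧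
    P {ω | ∃ k ∈ Finset.Icc 1 (min K H0.card),
        (k : ℕ) ≤ (H0.filter fun i =>
          p i ω < t k (LamKnown P q t K α Finset.univ)).card}
      ≤ ENNReal.ofReal α := by
  have hanti := fun (A A' : Finset (Fin m)) (hA : A.Nonempty) (h : A ⊆ A') =>
    LamKnown_anti P α hK ht0 (fun i ω => (hqrange i ω).1) hA h
  have hH0p : P {ω | Psi t K H0 (fun i => p i ω) < LamKnown P q t K α H0} ≤
      ENNReal.ofReal α := by
    refine (measure_mono_ae ?_).trans (measure_Psi_lt_LamKnown_le P q t K α H0)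
    filter_upwards [(Finset.eventually_all H0).2 hdom] with ω hω hlt
    exact (Psi_le_of_subset hK ht0 hH0 subset_rfl (fun i => (hqrange i ω).1) hω).trans_lt hlt
  refine ⟨hanti, hH0p, (measure_mono ?_).trans hH0p⟩
  rintro ω ⟨k, hk, hcard⟩
  have hk' := Finset.mem_Icc.1 hk
  obtain ⟨hkK, hkA⟩ := le_min_iff.1 hk'.2
  have hkK' := Finset.mem_Icc.2 ⟨hk'.1, hkK⟩
  rw [← orderStat_lt_iff H0 (fun i => p i ω) _ ⟨hk'.1, hkA⟩] at hcard
  exact ((Psi_le H0 _ hk').trans_lt (tinv_lt_of_lt (ht0 k hkK') (htmono k hkK') (htlc k hkK')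
    (LamKnown_mem_Icc P q t K α _)
    (orderStat_nonneg (fun i => (hprange i ω).1) ⟨hk'.1, hkA⟩) hcard)).trans_le
    (hanti _ _ hH0 (Finset.subset_univ _))
end
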